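/- Let T be a symmetric monoidal additive category with all small coproducts in which the tensor product commutes with coproducts in each variable, and let (F_i : T → T_i)_{i∈I} be a family of coproduct-preserving strong symmetric monoidal functors into such categories, each admitting a left adjoint L_i, satisfying the projection formula (for every X in T and Y in T_i there is an isomorphism L_i(F_iX ⊗ Y) ≅ X ⊗ L_iY) and the retract property (every object Y of T_i is a retract of F_iL_iY). Assume localising tensor ideals of T are detected on the family: for every localising tensor ideal L of T and every object X, X ∈ L if and only if L_iF_iX ∈ L for all i ∈ I. If every localising tensor ideal of every T_i is radical, then every localising tensor ideal of T is radical. -/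

import Mathlib

open CategoryTheory CategoryTheory.Limits MonoidalCategory

universe v u u₂

/-- A localising tensor ideal: a class of objects closed under isomorphisms, direct
summands (retracts), small coproducts, and tensoring with arbitrary objects. -/
def IsLocalisingTensorIdeal (C : Type u) [Category.{v} C] [Preadditive C]
    [MonoidalCategory C] [HasCoproducts.{v} C] (L : Set C) : Prop :=
  (∀ ⦃X Y : C⦄, (X ≅ Y) → X ∈ L → Y ∈ L) ∧
  (∀ ⦃X Y : C⦄ (i : X ⟶ Y) (r : Y ⟶ X), i ≫ r = 𝟙 X → Y ∈ L → X ∈ L) ∧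
  (∀ ⦃ι : Type v⦄ (f : ι → C), (∀ j, f j ∈ L) → (∐ f) ∈ L) ∧
  (∀ ⦃X : C⦄, X ∈ L → ∀ Y : C, (X ⊗ Y) ∈ L)

/-- `Loc⊗(S)`: the smallest localising tensor ideal containing `S`. -/
def locTensorIdealGen (C : Type u) [Category.{v} C] [Preadditive C]
    [MonoidalCategory C] [HasCoproducts.{v} C] (S : Set C) : Set C :=
  ⋂₀ {L : Set C | IsLocalisingTensorIdeal C L ∧ S ⊆ L}

/-- The `n`-fold tensor power of an object. -/
def tensorPow {C : Type u} [Category.{v} C] [MonoidalCategory C] (X : C) : ℕ → C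
  | 0 => 𝟙_ C
  | 1 => X
  | n + 2 => tensorPow X (n + 1) ⊗ X

/-- A localising tensor ideal is radical if `X^{⊗n} ∈ L` for some `n ≥ 1` implies `X ∈ L`. -/
def IsRadicalIdeal (C : Type u) [Category.{v} C] [MonoidalCategory C] (L : Set C) : Prop :=
  ∀ (X : C) (n : ℕ), 1 ≤ n → tensorPow X n ∈ L → X ∈ L

/-- A strong monoidal functor commutes with tensor powers. -/
theorem nonempty_map_tensorPow_iso {C : Type*} {D : Type*} [Category C] [Category D]
    [MonoidalCategory C] [MonoidalCategory D] (F : C ⥤ D) [F.Monoidal] (X : C) (n : ℕ) :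
    Nonempty (F.obj (tensorPow X n) ≅ tensorPow (F.obj X) n) := by
  induction n using Nat.twoStepInduction with
  | zero => exact ⟨(Functor.Monoidal.εIso F).symm⟩
  | one => exact ⟨Iso.refl _⟩
  | more n _ ih =>
    obtain ⟨e⟩ := ih
    exact ⟨(Functor.Monoidal.μIso F _ _).symm ≪≫ (e ⊗ᵢ Iso.refl _)⟩

/-- If `L` is left adjoint to `F`, and the projection formula and the retract property hold,
then the preimage under `L` of a localising tensor ideal is a localising tensor ideal. -/
theorem IsLocalisingTensorIdeal.preimage_leftAdjoint
    {C : Type u} [Category.{v} C] [Preadditive C] [MonoidalCategory C] [BraidedCategory C]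
    [HasCoproducts.{v} C]
    {D : Type u₂} [Category.{v} D] [Preadditive D] [MonoidalCategory D] [BraidedCategory D]
    [HasCoproducts.{v} D] {F : C ⥤ D} {L : D ⥤ C} (adj : L ⊣ F)
    (proj : ∀ (X : C) (Y : D), Nonempty (L.obj (F.obj X ⊗ Y) ≅ X ⊗ L.obj Y))
    (retr : ∀ Y : D, ∃ (j : Y ⟶ F.obj (L.obj Y)) (r : F.obj (L.obj Y) ⟶ Y), j ≫ r = 𝟙 Y)
    {S : Set C} (hS : IsLocalisingTensorIdeal C S) :
    IsLocalisingTensorIdeal D (L.obj ⁻¹' S) := by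
  obtain ⟨hiso, hretr, hcoprod, htensor⟩ := hS
  have := adj.leftAdjoint_preservesColimits
  refine ⟨fun X Y e hX => hiso (L.mapIso e) hX, fun X Y i r h hY => ?_, fun ι f hf => ?_,
    fun X hX Y => ?_⟩
  · exact hretr (L.map i) (L.map r) (by rw [← L.map_comp, h, L.map_id]) hY
  · exact hiso (PreservesCoproduct.iso L f).symm (hcoprod _ hf)
  · obtain ⟨j, r, hjr⟩ := retr Y
    obtain ⟨e⟩ := proj (L.obj Y) X
    refine hretr (L.map (X ◁ j)) (L.map (X ◁ r)) ?_
      (hiso (β_ _ _ ≪≫ e.symm ≪≫ L.mapIso (β_ _ _)) (htensor hX (L.obj Y)))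
    rw [← L.map_comp, ← MonoidalCategory.whiskerLeft_comp, hjr, MonoidalCategory.whiskerLeft_id,
      L.map_id]

/-- if localising tensor ideals of `T` are detected on a family of functors
whose targets only have radical localising tensor ideals, then every localising tensor
ideal of `T` is radical. -/
theorem statement13 {T : Type u} [Category.{v} T] [Preadditive T] [MonoidalCategory T]
    [SymmetricCategory T] [HasCoproducts.{v} T]
    [∀ (X : T) (ι : Type v), PreservesColimitsOfShape (Discrete ι) (tensorLeft X)]
    [∀ (X : T) (ι : Type v), PreservesColimitsOfShape (Discrete ι) (tensorRight X)]
    {I : Type v} (Ti : I → Type u₂) [∀ i, Category.{v} (Ti i)]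
    [∀ i, Preadditive (Ti i)] [∀ i, MonoidalCategory (Ti i)]
    [∀ i, SymmetricCategory (Ti i)] [∀ i, HasCoproducts.{v} (Ti i)]
    [∀ i (X : Ti i) (ι : Type v), PreservesColimitsOfShape (Discrete ι) (tensorLeft X)]
    [∀ i (X : Ti i) (ι : Type v), PreservesColimitsOfShape (Discrete ι) (tensorRight X)]
    -- the coproduct-preserving strong symmetric monoidal functors `F i : T ⥤ Ti i`
    (F : ∀ i, T ⥤ Ti i) [∀ i, (F i).Braided]
    [∀ i (ι : Type v), PreservesColimitsOfShape (Discrete ι) (F i)]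
    -- with left adjoints `L i`
    (Lf : ∀ i, Ti i ⥤ T) (adj : ∀ i, Lf i ⊣ F i)
    -- the projection formula
    (proj : ∀ i (X : T) (Y : Ti i),
      Nonempty ((Lf i).obj ((F i).obj X ⊗ Y) ≅ X ⊗ (Lf i).obj Y))
    -- the retract property
    (retr : ∀ i (Y : Ti i), ∃ (j : Y ⟶ (F i).obj ((Lf i).obj Y))
      (r : (F i).obj ((Lf i).obj Y) ⟶ Y), j ≫ r = 𝟙 Y)
    -- localising tensor ideals of `T` are detected on the family
    (detect : ∀ (L : Set T), IsLocalisingTensorIdeal T L →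
      ∀ X : T, X ∈ L ↔ ∀ i, (Lf i).obj ((F i).obj X) ∈ L)
    -- every localising tensor ideal of every `Ti i` is radical
    (hrad : ∀ i (L : Set (Ti i)), IsLocalisingTensorIdeal (Ti i) L → IsRadicalIdeal (Ti i) L) :
    ∀ L : Set T, IsLocalisingTensorIdeal T L → IsRadicalIdeal T L := by
  intro L hL X n hn hX
  refine (detect L hL X).2 fun i => ?_
  have hM := hL.preimage_leftAdjoint (adj i) (proj i) (retr i)
  obtain ⟨e⟩ := nonempty_map_tensorPow_iso (F i) X n
  exact hrad i _ hM _ n hn (hM.1 e ((detect L hL _).1 hX i))
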